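/- Let F : ℝ × ℝⁿ → (ℝⁿ →L ℝⁿ) be continuously differentiable with self-adjoint part S(t,p) = (F(t,p) + F(t,p)*)/2 with respect to the Euclidean inner product, and let V : ℝⁿ × ℝ → ℝ be twice continuously differentiable, with ∇ᴹV(p, t) denoting the Euclidean gradient of p ↦ V(p, t). Assume: (i) for each T > 0 there is a constant N_T such that ‖S(t,p)‖ ≤ N_T for all t ∈ [−T, T] and all p ∈ ℝⁿ; (ii) for each T > 0 there are constants A_T, C_T > 0 such that ‖∇ᴹV(p, t)‖ ≤ A_T ‖p‖ + C_T for all t ∈ [−T, T] and all p ∈ ℝⁿ. Then for every (p, v) ∈ ℝⁿ × ℝⁿ there exists a twice continuously differentiable curve γ : ℝ → ℝⁿ with γ(0) = p, γ'(0) = v, and γ''(t) = F(t, γ(t))(γ'(t)) − ∇ᴹV(γ(t), t) for all t ∈ ℝ. -/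

import Mathlib

/-- The self-adjoint part `(A + A*)/2` of a continuous linear operator on
Euclidean space, with respect to the Euclidean inner product. -/
noncomputable def selfAdjointPart' {n : ℕ}
    (A : EuclideanSpace ℝ (Fin n) →L[ℝ] EuclideanSpace ℝ (Fin n)) :
    EuclideanSpace ℝ (Fin n) →L[ℝ] EuclideanSpace ℝ (Fin n) :=
  (2⁻¹ : ℝ) • (A + ContinuousLinearMap.adjoint A)

open Set Metric in
/-- A `C¹` time-dependent field is Lipschitz in space on compact time-space boxes. -/
lemma aux_lipschitz {H : Type*} [NormedAddCommGroup H] [InnerProductSpace ℝ H]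
    [FiniteDimensional ℝ H] (X : ℝ → H → H)
    (hX : ContDiff ℝ 1 (Function.uncurry X)) (T R : ℝ) (c : H) :
    ∃ K : NNReal, ∀ t ∈ Icc (-T) T, LipschitzOnWith K (X t) (closedBall c R) := by
  have hc : IsCompact (Icc (-T) T ×ˢ closedBall c R) :=
    isCompact_Icc.prod (isCompact_closedBall c R)
  obtain ⟨K, hK⟩ := (hX.locallyLipschitz.locallyLipschitzOn
    (s := Icc (-T) T ×ˢ closedBall c R)).exists_lipschitzOnWith_of_compact hc
  refine ⟨K, fun t ht x hx y hy => ?_⟩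
  have := hK (x := (t, x)) ⟨ht, hx⟩ (y := (t, y)) ⟨ht, hy⟩
  simpa [Function.uncurry, Prod.edist_eq] using this

open Set Metric in
/-- One-directional a priori bound (forward in time). -/
lemma aux_gronwall {u u' : ℝ → ℝ} {T K : ℝ} (hK : 0 ≤ K)
    (hu : ∀ t ∈ Icc 0 T, HasDerivWithinAt u (u' t) (Icc 0 T) t)
    (hb : ∀ t ∈ Icc 0 T, |u' t| ≤ K * |u t|) :
    ∀ t ∈ Icc 0 T, |u t| ≤ |u 0| * Real.exp (K * T) := by
  intro t ht
  have := norm_le_gronwallBound_of_norm_deriv_right_le (f := u) (f' := u') (δ := |u 0|) (K := K)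
    (ε := 0) (a := 0) (b := T) (fun s hs => (hu s hs).continuousWithinAt)
    (fun s hs => ((hu s ⟨hs.1, hs.2.le⟩).mono_of_mem_nhdsWithin
      (Icc_mem_nhdsGE_of_mem hs)))
    le_rfl (fun s hs => by simpa using hb s ⟨hs.1, hs.2.le⟩) t ht
  rw [gronwallBound_ε0, Real.norm_eq_abs] at this
  refine this.trans ?_
  have : K * (t - 0) ≤ K * T := by
    have := ht.2
    gcongr
    linarith
  gcongr

open Set Metric in
/-- Solutions on compact intervals for fields with `|⟪z, X⟫| ≤ K (1 + ‖z‖²)`. -/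
lemma aux_local {H : Type*} [NormedAddCommGroup H] [InnerProductSpace ℝ H]
    [FiniteDimensional ℝ H] (X : ℝ → H → H)
    (hX : ContDiff ℝ 1 (Function.uncurry X)) (T : ℝ) (hT : 0 < T) (K : ℝ) (hK : 0 ≤ K)
    (hb : ∀ t ∈ Icc (-T) T, ∀ z, |inner ℝ z (X t z)| ≤ K * (1 + ‖z‖ ^ 2)) (z₀ : H) :
    ∃ R : ℝ, ∃ z : ℝ → H, z 0 = z₀ ∧
      ∀ t ∈ Ioo (-T) T, HasDerivAt z (X t (z t)) t ∧ z t ∈ closedBall (0 : H) R := by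
  set R : ℝ := (1 + ‖z₀‖ ^ 2) * Real.exp (2 * K * T) with hR
  have hRpos : 0 < R := by positivity
  let χ : ContDiffBump (0 : H) := ⟨R, R + 1, hRpos, by linarith⟩
  let Y : ℝ → H → H := fun t z => χ z • X t z
  have hY : ContDiff ℝ 1 (Function.uncurry Y) := by
    have h1 : ContDiff ℝ 1 (fun p : ℝ × H => χ p.2) := (χ.contDiff (n := 1)).comp contDiff_snd
    exact h1.smul hX
  obtain ⟨L, hL⟩ : ∃ L : NNReal, ∀ t ∈ Icc (-T) T, ∀ z, ‖Y t z‖ ≤ L := by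
    have hc : IsCompact (Icc (-T) T ×ˢ closedBall (0 : H) (R + 1)) :=
      isCompact_Icc.prod (isCompact_closedBall _ _)
    obtain ⟨C, hC⟩ := hc.exists_bound_of_continuousOn hY.continuous.continuousOn
    refine ⟨⟨max C 0, le_max_right _ _⟩, fun t ht z => ?_⟩
    by_cases hz : z ∈ closedBall (0 : H) (R + 1)
    · exact (hC (t, z) ⟨ht, hz⟩).trans (le_max_left _ _)
    · have : χ z = 0 := χ.zero_of_le_dist (by
        simp only [mem_closedBall, not_le] at hz
        exact hz.le)
      simp only [Y, this, zero_smul, norm_zero]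
      exact le_max_right _ _
  obtain ⟨M, hM⟩ := aux_lipschitz Y hY T (L * T) z₀
  have hT0 : (0 : ℝ) ∈ Icc (-T) T := ⟨by linarith, hT.le⟩
  have hPL : IsPicardLindelof Y (⟨0, hT0⟩ : Icc (-T) T) z₀ (L * ⟨T, hT.le⟩) 0 L M :=
    { lipschitzOnWith := hM
      continuousOn := fun x _ =>
        (hY.continuous.comp (continuous_id.prodMk continuous_const)).continuousOn
      norm_le := fun t ht x _ => hL t ht x
      mul_max_le := by
        simp only [sub_zero, zero_sub, neg_neg, max_self, NNReal.coe_zero]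
        exact le_rfl }
  obtain ⟨z, hz0, hz⟩ := hPL.exists_eq_forall_mem_Icc_hasDerivWithinAt₀
  simp only at hz0
  -- energy estimate
  let u : ℝ → ℝ := fun t => 1 + ‖z t‖ ^ 2
  let u' : ℝ → ℝ := fun t => 2 * inner ℝ (z t) (Y t (z t))
  have hu : ∀ t ∈ Icc (-T) T, HasDerivWithinAt u (u' t) (Icc (-T) T) t := fun t ht =>
    ((hz t ht).norm_sq).const_add 1
  have hupos : ∀ t, |u t| = 1 + ‖z t‖ ^ 2 := fun t => abs_of_pos (by positivity)
  have hub : ∀ t ∈ Icc (-T) T, |u' t| ≤ 2 * K * |u t| := by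
    intro t ht
    have h1 := hb t ht (z t)
    have h2 : |u' t| = 2 * (χ (z t) * |inner ℝ (z t) (X t (z t))|) := by
      simp only [u', Y, inner_smul_right, abs_mul, abs_two, abs_of_nonneg (χ.nonneg (x := z t))]
    rw [h2, hupos]
    have h3 : χ (z t) * |inner ℝ (z t) (X t (z t))| ≤ 1 * |inner ℝ (z t) (X t (z t))| := by
      gcongr
      exact χ.le_one
    linarith
  have hsub : Icc 0 T ⊆ Icc (-T) T := Icc_subset_Icc_left (by linarith)
  have hneg : MapsTo (fun t : ℝ => -t) (Icc 0 T) (Icc (-T) T) := fun t ht =>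
    ⟨by linarith [ht.2], by linarith [ht.1]⟩
  have hpos_bd := aux_gronwall (u := u) (u' := u') (T := T) (K := 2 * K) (by positivity)
    (fun t ht => (hu t (hsub ht)).mono hsub) (fun t ht => hub t (hsub ht))
  have hneg_bd := aux_gronwall (u := fun t => u (-t)) (u' := fun t => -u' (-t)) (T := T)
    (K := 2 * K) (by positivity)
    (fun t ht => by
      have := (hu (-t) (hneg ht)).scomp t (hasDerivAt_neg t).hasDerivWithinAt hneg
      simpa [Function.comp_def] using this)
    (fun t ht => by simpa using hub (-t) (hneg ht))
  have hbd : ∀ t ∈ Icc (-T) T, ‖z t‖ ≤ R := by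
    intro t ht
    have key : |u t| ≤ |u 0| * Real.exp (2 * K * T) := by
      rcases le_total 0 t with h | h
      · exact hpos_bd t ⟨h, ht.2⟩
      · simpa using hneg_bd (-t) ⟨by linarith, by linarith [ht.1]⟩
    rw [hupos, hupos, hz0] at key
    nlinarith [sq_nonneg (‖z t‖ - 1)]
  refine ⟨R, z, hz0, fun t ht => ?_⟩
  have ht' := Ioo_subset_Icc_self ht
  have hball : z t ∈ closedBall (0 : H) R := by simpa using hbd t ht'
  refine ⟨?_, hball⟩
  have h1 : χ (z t) = 1 := χ.one_of_mem_closedBall hball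
  have h2 := (hz t ht').hasDerivAt (Icc_mem_nhds ht.1 ht.2)
  simpa [Y, h1] using h2

open Set Metric in
/-- Global solutions. -/
lemma aux_global {H : Type*} [NormedAddCommGroup H] [InnerProductSpace ℝ H]
    [FiniteDimensional ℝ H] (X : ℝ → H → H)
    (hX : ContDiff ℝ 1 (Function.uncurry X))
    (hb : ∀ T > 0, ∃ K : ℝ, 0 ≤ K ∧ ∀ t ∈ Icc (-T) T, ∀ z,
      |inner ℝ z (X t z)| ≤ K * (1 + ‖z‖ ^ 2)) (z₀ : H) :
    ∃ z : ℝ → H, z 0 = z₀ ∧ ∀ t, HasDerivAt z (X t (z t)) t := by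
  have hloc : ∀ T : ℝ, 0 < T → ∃ R : ℝ, ∃ z : ℝ → H, z 0 = z₀ ∧
      ∀ t ∈ Ioo (-T) T, HasDerivAt z (X t (z t)) t ∧ z t ∈ closedBall (0 : H) R := by
    intro T hT
    obtain ⟨K, hK, h⟩ := hb T hT
    exact aux_local X hX T hT K hK h z₀
  choose! R z hz0 hz using hloc
  have huniq : ∀ S T, 0 < S → S ≤ T → EqOn (z S) (z T) (Ioo (-S) S) := by
    intro S T hS hST
    have hT : 0 < T := hS.trans_le hST
    obtain ⟨K, hK⟩ := aux_lipschitz X hX S (max (R S) (R T)) 0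
    refine ODE_solution_unique_of_mem_Ioo (v := X)
      (s := fun _ => closedBall (0 : H) (max (R S) (R T))) (t₀ := 0)
      (fun t ht => hK t (Ioo_subset_Icc_self ht)) ⟨by linarith, hS⟩ ?_ ?_ ?_
    · exact fun t ht => ⟨(hz S hS t ht).1,
        closedBall_subset_closedBall (le_max_left _ _) (hz S hS t ht).2⟩
    · intro t ht
      have ht' : t ∈ Ioo (-T) T := ⟨by linarith [ht.1], by linarith [ht.2]⟩
      exact ⟨(hz T hT t ht').1,
        closedBall_subset_closedBall (le_max_right _ _) (hz T hT t ht').2⟩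
    · rw [hz0 S hS, hz0 T hT]
  let w : ℝ → H := fun t => z (|t| + 1) t
  have hw : ∀ T, 0 < T → EqOn w (z T) (Ioo (-T) T) := by
    intro T hT t ht
    have h1 : t ∈ Ioo (-(|t| + 1)) (|t| + 1) := abs_lt.mp (by linarith)
    have hp : 0 < |t| + 1 := by positivity
    rcases le_total T (|t| + 1) with h | h
    · exact (huniq _ _ hT h ht).symm
    · exact huniq _ _ hp h h1
  refine ⟨w, ?_, fun t => ?_⟩
  · simp only [w]
    exact hz0 _ (by positivity)
  · have hp : 0 < |t| + 1 := by positivity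
    have h1 : t ∈ Ioo (-(|t| + 1)) (|t| + 1) := abs_lt.mp (by linarith)
    have h2 := (hz _ hp t h1).1
    exact h2.congr_of_eventuallyEq
      (Filter.eventuallyEq_of_mem (Ioo_mem_nhds h1.1 h1.2) (hw _ hp))

lemma aux_inner {n : ℕ} (A : EuclideanSpace ℝ (Fin n) →L[ℝ] EuclideanSpace ℝ (Fin n))
    (v : EuclideanSpace ℝ (Fin n)) :
    |inner ℝ v (A v)| ≤ ‖selfAdjointPart' A‖ * ‖v‖ ^ 2 := by
  have h : inner ℝ v (A v) = inner ℝ v (selfAdjointPart' A v) := by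
    simp only [selfAdjointPart', smul_apply, add_apply,
      inner_smul_right, inner_add_right, ContinuousLinearMap.adjoint_inner_right]
    rw [real_inner_comm v (A v)]
    ring
  rw [h]
  calc _ ≤ ‖v‖ * ‖selfAdjointPart' A v‖ := abs_real_inner_le_norm _ _
    _ ≤ ‖v‖ * (‖selfAdjointPart' A‖ * ‖v‖) := by
      gcongr
      exact ContinuousLinearMap.le_opNorm _ _
    _ = _ := by ring

/-- Corollary 1 on `ℝⁿ`: if the self-adjoint part of `F` is bounded along
finite times and the spatial gradient of `V` grows at most linearly along
finite times, then every inextensible solution of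
`γ'' = F(t,γ)(γ') − ∇ᴹV(γ,t)` is complete. -/
theorem completeness_bounded_S_linear_gradV {n : ℕ}
    (F : ℝ × EuclideanSpace ℝ (Fin n) →
      (EuclideanSpace ℝ (Fin n) →L[ℝ] EuclideanSpace ℝ (Fin n)))
    (hF : ContDiff ℝ 1 F)
    (V : EuclideanSpace ℝ (Fin n) × ℝ → ℝ)
    (hV : ContDiff ℝ 2 V)
    (hS : ∀ T > 0, ∃ N : ℝ, ∀ t ∈ Set.Icc (-T) T,
      ∀ p : EuclideanSpace ℝ (Fin n), ‖selfAdjointPart' (F (t, p))‖ ≤ N)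
    (hVgrowth : ∀ T > 0, ∃ A > 0, ∃ C > 0, ∀ t ∈ Set.Icc (-T) T,
      ∀ p : EuclideanSpace ℝ (Fin n),
        ‖gradient (fun q => V (q, t)) p‖ ≤ A * ‖p‖ + C) :
    ∀ p v : EuclideanSpace ℝ (Fin n),
      ∃ γ : ℝ → EuclideanSpace ℝ (Fin n), ContDiff ℝ 2 γ ∧
        γ 0 = p ∧ deriv γ 0 = v ∧
        ∀ t : ℝ, deriv (deriv γ) t
          = F (t, γ t) (deriv γ t) - gradient (fun q => V (q, t)) (γ t) := by
  intro p v
  let E := EuclideanSpace ℝ (Fin n)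
  let G : ℝ → E → E := fun t q => gradient (fun q => V (q, t)) q
  have hG : ContDiff ℝ 1 (Function.uncurry G) := by
    have h1 : ContDiff ℝ 1 (fun x : ℝ × E => fderiv ℝ (fun q => V (q, x.1)) x.2) := by
      refine ContDiff.fderiv (m := 2) (f := fun (x : ℝ × E) q => V (q, x.1)) ?_ contDiff_snd
        (by norm_num)
      exact hV.comp (contDiff_snd.prodMk (contDiff_fst.comp contDiff_fst))
    exact (InnerProductSpace.toDual ℝ E).symm.contDiff.comp h1
  let X : ℝ → WithLp 2 (E × E) → WithLp 2 (E × E) := fun t z =>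
    WithLp.toLp 2 (z.snd, F (t, z.fst) z.snd - G t z.fst)
  have hfst : ContDiff ℝ 1 (fun z : WithLp 2 (E × E) => z.fst) :=
    (WithLp.fstL 2 ℝ E E).contDiff
  have hsnd : ContDiff ℝ 1 (fun z : WithLp 2 (E × E) => z.snd) :=
    (WithLp.sndL 2 ℝ E E).contDiff
  have hX : ContDiff ℝ 1 (Function.uncurry X) := by
    have h1 : ContDiff ℝ 1 (fun x : ℝ × WithLp 2 (E × E) => x.2.fst) := hfst.comp contDiff_snd
    have h2 : ContDiff ℝ 1 (fun x : ℝ × WithLp 2 (E × E) => x.2.snd) := hsnd.comp contDiff_snd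
    have h3 : ContDiff ℝ 1 (fun x : ℝ × WithLp 2 (E × E) => (x.1, x.2.fst)) :=
      contDiff_fst.prodMk h1
    have h4 := h2.prodMk (((hF.comp h3).clm_apply h2).sub (hG.comp h3))
    exact (WithLp.prodContinuousLinearEquiv 2 ℝ E E).symm.contDiff.comp h4
  have hb : ∀ T > 0, ∃ K : ℝ, 0 ≤ K ∧ ∀ t ∈ Set.Icc (-T) T, ∀ z,
      |inner ℝ z (X t z)| ≤ K * (1 + ‖z‖ ^ 2) := by
    intro T hT
    obtain ⟨N, hN⟩ := hS T hT
    obtain ⟨A, hA, C, hC, hAC⟩ := hVgrowth T hT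
    refine ⟨1 + |N| + A + C, by positivity, fun t ht z => ?_⟩
    have e1 : inner ℝ z (X t z) = inner ℝ z.fst z.snd + (inner ℝ z.snd (F (t, z.fst) z.snd)
        - inner ℝ z.snd (G t z.fst)) := by
      simp only [X, WithLp.prod_inner_apply, inner_sub_right]
      rfl
    have e2 : ‖z‖ ^ 2 = ‖z.fst‖ ^ 2 + ‖z.snd‖ ^ 2 := WithLp.prod_norm_sq_eq_of_L2 z
    rw [e1, e2]
    have a1 := abs_real_inner_le_norm z.fst z.snd
    have a2 := aux_inner (F (t, z.fst)) z.snd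
    have a3 := abs_real_inner_le_norm z.snd (G t z.fst)
    have a4 : ‖G t z.fst‖ ≤ A * ‖z.fst‖ + C := hAC t ht z.fst
    have a5 : ‖selfAdjointPart' (F (t, z.fst))‖ ≤ |N| := (hN t ht z.fst).trans (le_abs_self N)
    have a6 : ‖selfAdjointPart' (F (t, z.fst))‖ * ‖z.snd‖ ^ 2 ≤ |N| * ‖z.snd‖ ^ 2 := by gcongr
    have a7 : ‖z.snd‖ * ‖G t z.fst‖ ≤ ‖z.snd‖ * (A * ‖z.fst‖ + C) := by gcongr
    have t1 := abs_add_le (inner ℝ z.fst z.snd)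
      (inner ℝ z.snd (F (t, z.fst) z.snd) - inner ℝ z.snd (G t z.fst))
    have t2 := abs_sub (inner ℝ z.snd (F (t, z.fst) z.snd)) (inner ℝ z.snd (G t z.fst))
    have hN0 := abs_nonneg N
    generalize ‖z.fst‖ = a at *
    generalize ‖z.snd‖ = b at *
    have b1 : a * b ≤ 1 + (a ^ 2 + b ^ 2) := by nlinarith [sq_nonneg (a - b), sq_nonneg (a + b)]
    have b2 : b ≤ 1 + (a ^ 2 + b ^ 2) := by nlinarith [sq_nonneg (b - 1)]
    have b3 : b ^ 2 ≤ 1 + (a ^ 2 + b ^ 2) := by nlinarith [sq_nonneg a]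
    have c1 := mul_le_mul_of_nonneg_left b1 hA.le
    have c2 := mul_le_mul_of_nonneg_left b2 hC.le
    have c3 := mul_le_mul_of_nonneg_left b3 hN0
    linarith
  obtain ⟨z, hz0, hz⟩ := aux_global X hX hb (WithLp.toLp 2 (p, v))
  have d1 : ∀ t, HasDerivAt (fun t => (z t).fst) (z t).snd t := fun t =>
    (WithLp.fstL 2 ℝ E E).hasFDerivAt.comp_hasDerivAt t (hz t)
  have d2 : ∀ t, HasDerivAt (fun t => (z t).snd)
      (F (t, (z t).fst) (z t).snd - G t (z t).fst) t := fun t =>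
    (WithLp.sndL 2 ℝ E E).hasFDerivAt.comp_hasDerivAt t (hz t)
  have e1 : deriv (fun t => (z t).fst) = fun t => (z t).snd := funext fun t => (d1 t).deriv
  have hzc : Continuous z := continuous_iff_continuousAt.2 fun t => (hz t).continuousAt
  have hder : ∀ t, deriv z t = X t (z t) := fun t => (hz t).deriv
  have c1 : ContDiff ℝ 1 z := by
    rw [contDiff_one_iff_deriv]
    refine ⟨fun t => (hz t).differentiableAt, ?_⟩
    rw [funext hder]
    exact hX.continuous.comp (continuous_id.prodMk hzc)
  refine ⟨fun t => (z t).fst, ?_, ?_, ?_, fun t => ?_⟩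
  · have : ContDiff ℝ (1 + 1) (fun t => (z t).fst) := by
      rw [contDiff_succ_iff_deriv]
      refine ⟨fun t => (d1 t).differentiableAt, by simp, ?_⟩
      rw [e1]
      exact hsnd.comp c1
    exact this.of_le (by norm_num)
  · simp [hz0]
  · simp [e1, hz0]
  · rw [e1, (d2 t).deriv]
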